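/- Let μ be a compactly supported probability measure on ℝ with infinite support, and let f : ℝ → ℝ be bounded and continuous. Then the variance of the linear statistic of the OPE of size n associated with μ satisfies Var X_f^{(n)} = o(n) as n → ∞. -/

import Mathlib

open MeasureTheory ProbabilityTheory Filter Topology

noncomputable section

/-- The squared Vandermonde determinant `∏_{i>j} (λ_i - λ_j)^2`. -/
def vandSq {n : ℕ} (l : Fin n → ℝ) : ℝ :=
  ∏ q ∈ Finset.univ.filter (fun q : Fin n × Fin n => q.2 < q.1), (l q.1 - l q.2) ^ 2

/-- The orthogonal polynomial ensemble of size `n` associated with `μ`: the probability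
measure on `ℝ^n` proportional to `∏_{i>j}(λ_i-λ_j)^2 dμ(λ_1)⋯dμ(λ_n)`. -/
def OPE (μ : Measure ℝ) (n : ℕ) : Measure (Fin n → ℝ) :=
  ((((Measure.pi fun _ : Fin n => μ).withDensity fun l => ENNReal.ofReal (vandSq l))
    Set.univ)⁻¹) •
    ((Measure.pi fun _ : Fin n => μ).withDensity fun l => ENNReal.ofReal (vandSq l))

/-- The linear statistic `X_f = ∑ f(λ_j)`. -/
def linStat {n : ℕ} (f : ℝ → ℝ) (l : Fin n → ℝ) : ℝ := ∑ j, f (l j)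

/-- The scaled linear statistic `X_{f,α,x*} = ∑ f(n^α (λ_j - x*))`. -/
def scaledLinStat {n : ℕ} (f : ℝ → ℝ) (α xs : ℝ) (l : Fin n → ℝ) : ℝ :=
  ∑ j, f ((n : ℝ) ^ α * (l j - xs))

/-- `p` is the family of orthonormal polynomials of `μ`: `p j` has degree `j`, positive
leading coefficient, and `∫ p_i p_j dμ = δ_{ij}`. -/
def IsOrthonormalPolys (μ : Measure ℝ) (p : ℕ → Polynomial ℝ) : Prop :=
  (∀ j, (p j).degree = (j : WithBot ℕ)) ∧ (∀ j, 0 < (p j).leadingCoeff) ∧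
    ∀ i j, ∫ x, (p i).eval x * (p j).eval x ∂μ = if i = j then 1 else 0

/-- All moments of `μ` are finite. -/
def HasAllMoments (μ : Measure ℝ) : Prop := ∀ k : ℕ, Integrable (fun x : ℝ => x ^ k) μ

/-- `μ` has infinite support: no finite set carries full `μ`-measure. -/
def InfiniteSupport (μ : Measure ℝ) : Prop := ∀ s : Finset ℝ, μ ((↑s : Set ℝ)ᶜ) ≠ 0

/-- The Christoffel–Darboux kernel `K_n(x,y) = ∑_{j<n} p_j(x) p_j(y)`. -/
def CDKernel (p : ℕ → Polynomial ℝ) (n : ℕ) (x y : ℝ) : ℝ :=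
  ∑ j ∈ Finset.range n, (p j).eval x * (p j).eval y

/-- The sup norm `‖f‖_∞` of a (bounded) function. -/
def supNorm (f : ℝ → ℝ) : ℝ := ⨆ x, |f x|

/-- The (topological) support of a measure on `ℝ`. -/
def measSupport (μ : Measure ℝ) : Set ℝ := {x | ∀ U ∈ 𝓝 x, μ U ≠ 0}

/-- The sine kernel `sin(πt)/(πt)` (equal to `1` at `t = 0`). -/
def sineKernel (t : ℝ) : ℝ := if t = 0 then 1 else Real.sin (Real.pi * t) / (Real.pi * t)

/-- `K̃_n(x,y) = w(x)^{1/2} w(y)^{1/2} K_n(x,y)`, where `w` is the Radon–Nikodym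
derivative of `μ` with respect to Lebesgue measure. -/
def tildeK (μ : Measure ℝ) (Kf : ℝ → ℝ → ℝ) (x y : ℝ) : ℝ :=
  Real.sqrt ((μ.rnDeriv volume x).toReal) * Real.sqrt ((μ.rnDeriv volume y).toReal) * Kf x y

/-- The Nevai condition at `x*` for a sequence of measures with kernels `Kf n`. -/
def NevaiCond (μ : ℕ → Measure ℝ) (Kf : ℕ → ℝ → ℝ → ℝ) (xs : ℝ) : Prop :=
  ∀ f : ℝ → ℝ, Continuous f → HasCompactSupport f →
    Tendsto (fun n => ∫ y, (f y - f xs) * Kf n xs y ^ 2 / Kf n xs xs ∂(μ n)) atTop (𝓝 0)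

/-- The `α`-Nevai condition at `x*` for a sequence of measures with kernels `Kf n`. -/
def AlphaNevaiCond (μ : ℕ → Measure ℝ) (Kf : ℕ → ℝ → ℝ → ℝ) (α xs : ℝ) : Prop :=
  ∀ f : ℝ → ℝ, Continuous f → HasCompactSupport f →
    ∀ S : Set ℝ, IsCompact S →
      TendstoUniformlyOn
        (fun n s => ∫ y, (f s - f ((n : ℝ) ^ α * (y - xs))) *
            Kf n (xs + s / (n : ℝ) ^ α) y ^ 2 /
            Kf n (xs + s / (n : ℝ) ^ α) (xs + s / (n : ℝ) ^ α) ∂(μ n))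
        (fun _ => 0) atTop S

/-- **Andréief's identity**, together with the integrability of the integrand. -/
theorem integral_det_mul_det {X : Type*} [MeasurableSpace X] (μ : Measure X) [SigmaFinite μ]
    {n : ℕ} (φ ψ : Fin n → X → ℝ) (h : ∀ i j, Integrable (fun x => φ i x * ψ j x) μ) :
    Integrable (fun x : Fin n → X => (Matrix.of fun i j => φ i (x j)).det *
      (Matrix.of fun i j => ψ i (x j)).det) (Measure.pi fun _ => μ) ∧
    ∫ x : Fin n → X, (Matrix.of fun i j => φ i (x j)).det *
      (Matrix.of fun i j => ψ i (x j)).det ∂(Measure.pi fun _ => μ) =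
      n.factorial * (Matrix.of fun i j => ∫ x, φ i x * ψ j x ∂μ).det := by
  have expand : (fun x : Fin n → X => (Matrix.of fun i j => φ i (x j)).det *
      (Matrix.of fun i j => ψ i (x j)).det) = fun x => ∑ σ : Equiv.Perm (Fin n),
        ∑ τ : Equiv.Perm (Fin n), ((Equiv.Perm.sign σ : ℤ) : ℝ) * ((Equiv.Perm.sign τ : ℤ) : ℝ) *
          ∏ i, (φ (σ i) (x i) * ψ (τ i) (x i)) := by
    funext x
    rw [Matrix.det_apply', Matrix.det_apply', Finset.sum_mul_sum]
    refine Finset.sum_congr rfl fun σ _ => Finset.sum_congr rfl fun τ _ => ?_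
    simp only [Matrix.of_apply, Finset.prod_mul_distrib]
    ring
  have h_int (σ τ : Equiv.Perm (Fin n)) : Integrable (fun x : Fin n → X =>
      ((Equiv.Perm.sign σ : ℤ) : ℝ) * ((Equiv.Perm.sign τ : ℤ) : ℝ) *
          ∏ i, (φ (σ i) (x i) * ψ (τ i) (x i))) (Measure.pi fun _ => μ) :=
    (Integrable.fintype_prod (f := fun i y => φ (σ i) y * ψ (τ i) y)
      fun i => h (σ i) (τ i)).const_mul _
  rw [expand]
  refine ⟨integrable_finsetSum _ fun σ _ => integrable_finsetSum _ fun τ _ => h_int σ τ, ?_⟩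
  rw [integral_finsetSum _ fun σ _ => integrable_finsetSum _ fun τ _ => h_int σ τ]
  have inner (σ : Equiv.Perm (Fin n)) : ∫ x : Fin n → X, ∑ τ : Equiv.Perm (Fin n),
      ((Equiv.Perm.sign σ : ℤ) : ℝ) * ((Equiv.Perm.sign τ : ℤ) : ℝ) *
          ∏ i, (φ (σ i) (x i) * ψ (τ i) (x i)) ∂(Measure.pi fun _ => μ) =
      (Matrix.of fun i j => ∫ x, φ i x * ψ j x ∂μ).det := by
    rw [integral_finsetSum _ fun τ _ => h_int σ τ]
    have hσ := Matrix.det_permute σ (Matrix.of fun i j => ∫ x, φ i x * ψ j x ∂μ)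
    have hs : ((Equiv.Perm.sign σ : ℤ) : ℝ) * ((Equiv.Perm.sign σ : ℤ) : ℝ) = 1 := by
      rw [← Int.cast_mul, ← Units.val_mul, Int.units_mul_self]; simp
    calc _ = ((Equiv.Perm.sign σ : ℤ) : ℝ) *
          ((Matrix.of fun i j => ∫ x, φ i x * ψ j x ∂μ).submatrix σ id).det := by
          rw [← Matrix.det_transpose, Matrix.det_apply', Finset.mul_sum]
          refine Finset.sum_congr rfl fun τ _ => ?_
          rw [integral_const_mul,
            integral_fintype_prod_eq_prod (fun i y => φ (σ i) y * ψ (τ i) y)]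
          simp [mul_assoc]
      _ = _ := by rw [hσ, ← mul_assoc, hs, one_mul]
  simp [inner, Fintype.card_perm]

/-- Multiplying each row in turn by the diagonal matrix with entries `g` and summing the resulting
determinants multiplies the determinant by the trace. -/
theorem sum_det_updateRow_mul {n : ℕ} (M : Matrix (Fin n) (Fin n) ℝ) (g : Fin n → ℝ) :
    ∑ k, (M.updateRow k (fun j => g j * M k j)).det = (∑ j, g j) * M.det := by
  have row (k : Fin n) : (M.updateRow k (fun j => g j * M k j)).det =
      ∑ j, g j * M k j * M.adjugate j k := by
    rw [← Matrix.cramer_transpose_apply, Matrix.cramer_eq_adjugate_mulVec, Matrix.mulVec,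
      dotProduct]
    refine Finset.sum_congr rfl fun j _ => ?_
    rw [← Matrix.adjugate_transpose, Matrix.transpose_apply]
    ring
  simp only [row]
  rw [Finset.sum_comm, Finset.sum_mul]
  refine Finset.sum_congr rfl fun j _ => ?_
  have := congrFun (congrFun (Matrix.adjugate_mul M) j) j
  simp only [Matrix.mul_apply, Matrix.smul_apply, Matrix.one_apply_eq, smul_eq_mul, mul_one] at this
  rw [← this, Finset.mul_sum]
  exact Finset.sum_congr rfl fun k _ => by ring

/-- Bessel's best approximation property in `L²(μ)`. -/
theorem integral_sub_proj_sq_le (μ : Measure ℝ) (hI : ∀ g : ℝ → ℝ, Continuous g → Integrable g μ)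
    {n : ℕ} (p : Fin n → ℝ → ℝ) (hp : ∀ i, Continuous (p i))
    (ho : ∀ i j, ∫ x, p i x * p j x ∂μ = if i = j then 1 else 0)
    (h : ℝ → ℝ) (hh : Continuous h) (c : Fin n → ℝ) :
    ∫ x, (h x - ∑ j, (∫ y, h y * p j y ∂μ) * p j x) ^ 2 ∂μ ≤
      ∫ x, (h x - ∑ j, c j * p j x) ^ 2 ∂μ := by
  set a : Fin n → ℝ := fun j => ∫ y, h y * p j y ∂μ with ha
  set r : ℝ → ℝ := fun x => h x - ∑ j, a j * p j x with hr
  have hrc : Continuous r := by fun_prop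
  have hrp (i : Fin n) : ∫ x, r x * p i x ∂μ = 0 := by
    have : ∀ x, r x * p i x = h x * p i x - ∑ j, a j * (p j x * p i x) := fun x => by
      simp only [hr, sub_mul, Finset.sum_mul, mul_assoc]
    simp_rw [this]
    rw [integral_sub (hI _ (by fun_prop)) (hI _ (by fun_prop)),
      integral_finsetSum _ fun j _ => hI _ (by fun_prop)]
    simp_rw [integral_const_mul, ho]
    simp [ha]
  have hcross : ∫ x, r x * ∑ j, (a j - c j) * p j x ∂μ = 0 := by
    have : ∀ x, r x * ∑ j, (a j - c j) * p j x = ∑ j, (a j - c j) * (r x * p j x) := fun x => by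
      rw [Finset.mul_sum]
      exact Finset.sum_congr rfl fun j _ => by ring
    simp_rw [this]
    rw [integral_finsetSum _ fun j _ => hI _ (by fun_prop)]
    simp [integral_const_mul, hrp]
  have hdecomp : ∀ x, (h x - ∑ j, c j * p j x) ^ 2 = r x ^ 2 +
      2 * (r x * ∑ j, (a j - c j) * p j x) + (∑ j, (a j - c j) * p j x) ^ 2 := fun x => by
    have : ∑ j, (a j - c j) * p j x = ∑ j, a j * p j x - ∑ j, c j * p j x := by
      rw [← Finset.sum_sub_distrib]
      exact Finset.sum_congr rfl fun j _ => by ring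
    rw [this]
    simp only [hr]
    ring
  simp_rw [hdecomp]
  rw [integral_add (hI _ (by fun_prop)) (hI _ (by fun_prop)),
    integral_add (hI _ (by fun_prop)) (hI _ (by fun_prop)), integral_const_mul, hcross]
  have : 0 ≤ ∫ x, (∑ j, (a j - c j) * p j x) ^ 2 ∂μ := integral_nonneg fun x => sq_nonneg _
  change ∫ x, r x ^ 2 ∂μ ≤ _
  linarith

/-- Centred version of `sum_det_updateRow_mul`: combinations of the rows are subtracted. -/
theorem sub_trace_mul_det {n : ℕ} (M c : Matrix (Fin n) (Fin n) ℝ) (g : Fin n → ℝ) :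
    (∑ j, g j - ∑ k, c k k) * M.det =
      ∑ k, (M.updateRow k (fun j => g j * M k j - ∑ i, c k i * M i j)).det := by
  have row (k : Fin n) : (M.updateRow k (fun j => g j * M k j)).det =
      (M.updateRow k (fun j => g j * M k j - ∑ i, c k i * M i j)).det + c k k * M.det := by
    rw [← smul_eq_mul, ← Matrix.det_updateRow_sum M k (c k), ← Matrix.det_updateRow_add]
    congr 2
    funext j
    simp
  rw [sub_mul, ← sum_det_updateRow_mul, Finset.sum_congr rfl fun k _ => row k,
    Finset.sum_add_distrib, Finset.sum_mul]
  ring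

theorem vandSq_eq_det_sq {n : ℕ} (x : Fin n → ℝ) : vandSq x = (Matrix.vandermonde x).det ^ 2 := by
  rw [Matrix.det_vandermonde, ← Finset.prod_pow, vandSq, Finset.prod_filter,
    Fintype.prod_prod_type_right]
  refine Finset.prod_congr rfl fun i _ => ?_
  rw [← Finset.prod_pow, ← Finset.prod_filter]
  exact Finset.prod_congr (by ext; simp) fun _ _ => rfl

/-- Evaluating polynomials of degree less than `n` at `n` points gives a multiple of the
Vandermonde determinant. -/
theorem det_eval_eq_mul_vandermonde {n : ℕ} (p : Fin n → Polynomial ℝ)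
    (hp : ∀ i, p i ∈ Polynomial.degreeLT ℝ n) (x : Fin n → ℝ) :
    (Matrix.of fun i j => (p i).eval (x j)).det =
      (Matrix.of fun i j : Fin n => (p i).coeff j).det * (Matrix.vandermonde x).det := by
  rw [← Matrix.det_transpose (Matrix.vandermonde x), ← Matrix.det_mul]
  congr 1
  ext i j
  rw [Matrix.of_apply, Matrix.mul_apply]
  simp only [Matrix.of_apply, Matrix.transpose_apply, Matrix.vandermonde_apply]
  rcases eq_or_ne (p i) 0 with h0 | h0
  · simp [h0]
  rw [Polynomial.eval_eq_sum_range' (n := n), Finset.sum_range]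
  exact (Polynomial.natDegree_lt_iff_degree_lt h0).2 (Polynomial.mem_degreeLT.1 (hp i))

/-- Residuals orthogonal to an orthonormal family give orthogonal determinants after a
row replacement. -/
theorem integral_det_update_mul_det_update (μ : Measure ℝ) [SigmaFinite μ]
    (hI : ∀ g : ℝ → ℝ, Continuous g → Integrable g μ)
    {n : ℕ} (p r : Fin n → ℝ → ℝ) (hp : ∀ i, Continuous (p i)) (hr : ∀ i, Continuous (r i))
    (ho : ∀ i j, ∫ x, p i x * p j x ∂μ = if i = j then 1 else 0)
    (hrp : ∀ i j, ∫ x, p i x * r j x ∂μ = 0) (k l : Fin n) :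
    Integrable (fun x : Fin n → ℝ =>
      (Matrix.of fun i j => Function.update p k (r k) i (x j)).det *
        (Matrix.of fun i j => Function.update p l (r l) i (x j)).det) (Measure.pi fun _ => μ) ∧
    ∫ x : Fin n → ℝ, (Matrix.of fun i j => Function.update p k (r k) i (x j)).det *
      (Matrix.of fun i j => Function.update p l (r l) i (x j)).det ∂(Measure.pi fun _ => μ) =
      if k = l then n.factorial * ∫ x, r k x ^ 2 ∂μ else 0 := by
  have hc (k i : Fin n) : Continuous (Function.update p k (r k) i) := by
    rw [Function.update_apply]; split_ifs; exacts [hr k, hp i]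
  obtain ⟨h1, h2⟩ := integral_det_mul_det μ (Function.update p k (r k))
    (Function.update p l (r l)) fun i j => hI _ ((hc k i).mul (hc l j))
  refine ⟨h1, h2.trans ?_⟩
  split_ifs with hkl
  · subst hkl
    have : (Matrix.of fun i j => ∫ x, Function.update p k (r k) i x *
        Function.update p k (r k) j x ∂μ) =
        Matrix.diagonal (Function.update 1 k (∫ x, r k x ^ 2 ∂μ)) := by
      ext i j
      simp only [Matrix.of_apply, Matrix.diagonal_apply, Function.update_apply]
      by_cases hi : i = k <;> by_cases hj : j = k <;> subst_vars
      · simp [pow_two]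
      · simp [hj, Ne.symm hj, mul_comm, hrp]
      · simp [hi, hrp]
      · simp [hi, hj, ho]
    rw [this, Matrix.det_diagonal, Finset.prod_update_of_mem (Finset.mem_univ k)]
    simp
  · rw [Matrix.det_eq_zero_of_row_eq_zero l, mul_zero]
    intro j
    simp only [Matrix.of_apply, Function.update_apply, if_neg (Ne.symm hkl)]
    by_cases hj : j = l
    · simp [hj, hrp]
    · simp [hj, Ne.symm hj, ho]

theorem continuous_vandSq {n : ℕ} : Continuous (vandSq : (Fin n → ℝ) → ℝ) := by
  unfold vandSq; fun_prop

theorem vandSq_nonneg {n : ℕ} (x : Fin n → ℝ) : 0 ≤ vandSq x :=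
  Finset.prod_nonneg fun _ _ => sq_nonneg _

theorem integral_OPE (μ : Measure ℝ) [IsProbabilityMeasure μ] {n : ℕ}
    (h_int : Integrable (vandSq : (Fin n → ℝ) → ℝ) (Measure.pi fun _ => μ))
    (F : (Fin n → ℝ) → ℝ) :
    ∫ x, F x ∂(OPE μ n) = (∫ x : Fin n → ℝ, vandSq x ∂(Measure.pi fun _ => μ))⁻¹ *
      ∫ x, F x * vandSq x ∂(Measure.pi fun _ => μ) := by
  rw [OPE, integral_smul_measure, integral_withDensity_eq_integral_toReal_smul
    (by have := continuous_vandSq (n := n); fun_prop) (by simp), withDensity_apply _ .univ,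
    Measure.restrict_univ, ← ofReal_integral_eq_lintegral_ofReal h_int (.of_forall vandSq_nonneg),
    ENNReal.toReal_inv, ENNReal.toReal_ofReal (integral_nonneg vandSq_nonneg), smul_eq_mul]
  congr 1
  refine integral_congr_ae (.of_forall fun x => ?_)
  simp only [smul_eq_mul]
  rw [ENNReal.toReal_ofReal (vandSq_nonneg x), mul_comm]

theorem isProbabilityMeasure_OPE (μ : Measure ℝ) [IsProbabilityMeasure μ] {n : ℕ}
    (h_int : Integrable (vandSq : (Fin n → ℝ) → ℝ) (Measure.pi fun _ => μ))
    (hpos : 0 < ∫ x : Fin n → ℝ, vandSq x ∂(Measure.pi fun _ => μ)) :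
    IsProbabilityMeasure (OPE μ n) := by
  constructor
  rw [OPE, Measure.smul_apply, smul_eq_mul]
  refine ENNReal.inv_mul_cancel ?_ ?_ <;>
  rw [withDensity_apply _ .univ, Measure.restrict_univ,
    ← ofReal_integral_eq_lintegral_ofReal h_int (.of_forall vandSq_nonneg)]
  · simpa using hpos
  · simp

/-- The variance of a linear statistic is at most the sum of the squared `L²(μ)` distances
from the functions `f p_k` to the span of the orthonormal polynomials of degree less than `n`. -/
theorem variance_linStat_le (μ : Measure ℝ) [IsProbabilityMeasure μ]
    (hI : ∀ g : ℝ → ℝ, Continuous g → Integrable g μ) {n : ℕ} (p : Fin n → Polynomial ℝ)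
    (hdeg : ∀ i, p i ∈ Polynomial.degreeLT ℝ n)
    (ho : ∀ i j, ∫ x, (p i).eval x * (p j).eval x ∂μ = if i = j then 1 else 0)
    (f : ℝ → ℝ) (hf : Continuous f) :
    variance (fun l : Fin n → ℝ => linStat f l) (OPE μ n) ≤
      ∑ k, ∫ x, (f x * (p k).eval x -
        ∑ j, (∫ y, f y * (p k).eval y * (p j).eval y ∂μ) * (p j).eval x) ^ 2 ∂μ := by
  set c : Matrix (Fin n) (Fin n) ℝ :=
    Matrix.of fun k j => ∫ y, f y * (p k).eval y * (p j).eval y ∂μ with hc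
  set r : Fin n → ℝ → ℝ :=
    fun k x => f x * (p k).eval x - ∑ j, c k j * (p j).eval x with hr
  set P : Fin n → ℝ → ℝ := fun i x => (p i).eval x with hP
  set M : (Fin n → ℝ) → Matrix (Fin n) (Fin n) ℝ := fun x => Matrix.of fun i j => P i (x j) with hM
  change _ ≤ ∑ k, ∫ x, r k x ^ 2 ∂μ
  have hPc (i) : Continuous (P i) := (p i).continuous
  have hrc (k) : Continuous (r k) := by fun_prop
  have hrp (i k) : ∫ x, P i x * r k x ∂μ = 0 := by
    have : ∀ x, P i x * r k x = f x * P k x * P i x - ∑ j, c k j * (P j x * P i x) := fun x => by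
      simp only [hr, mul_sub, Finset.mul_sum]
      congr 1
      · ring
      · exact Finset.sum_congr rfl fun j _ => by ring
    simp_rw [this]
    rw [integral_sub (hI _ (by fun_prop)) (hI _ (by fun_prop)),
      integral_finsetSum _ fun j _ => hI _ (by fun_prop)]
    simp_rw [integral_const_mul, hP, ho]
    simp [hc]
  have hD (k l) := integral_det_update_mul_det_update μ hI P r hPc hrc ho hrp k l
  have hdetD (k x) : (Matrix.of fun i j => Function.update P k (r k) i (x j)).det =
      ((M x).updateRow k
        (fun j => f (x j) * M x k j - ∑ i, c k i * M x i j)).det := by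
    congr 1
    ext i j
    by_cases hi : i = k
    · subst hi; simp [hr, hM, hP]
    · simp [hi, hM]
  have hsum (x) : (linStat f x - ∑ k, c k k) ^ 2 * (M x).det ^ 2 =
      ∑ k, ∑ l, (Matrix.of fun i j => Function.update P k (r k) i (x j)).det *
        (Matrix.of fun i j => Function.update P l (r l) i (x j)).det := by
    rw [← mul_pow, linStat, sub_trace_mul_det, ← Finset.sum_mul_sum, ← pow_two]
    simp only [hdetD]
  have hnum : ∫ x, (linStat f x - ∑ k, c k k) ^ 2 * (M x).det ^ 2 ∂(Measure.pi fun _ => μ) =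
      n.factorial * ∑ k, ∫ x, r k x ^ 2 ∂μ := by
    simp_rw [hsum]
    rw [integral_finsetSum _ fun k _ => integrable_finsetSum _ fun l _ => (hD k l).1,
      Finset.mul_sum]
    refine Finset.sum_congr rfl fun k _ => ?_
    rw [integral_finsetSum _ fun l _ => (hD k l).1]
    simp [hD]
  obtain ⟨hden_int, hden⟩ := integral_det_mul_det μ P P fun i j => hI _ (by fun_prop)
  have hone : (Matrix.of fun i j => ∫ x, P i x * P j x ∂μ) = 1 := by
    ext i j
    simp [hP, ho, Matrix.one_apply]
  rw [hone, Matrix.det_one, mul_one] at hden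
  set a : ℝ := (Matrix.of fun i j : Fin n => (p i).coeff j).det ^ 2 with ha
  have hv (x) : (M x).det ^ 2 = a * vandSq x := by
    simp only [hM, hP]
    rw [det_eval_eq_mul_vandermonde p hdeg, vandSq_eq_det_sq, mul_pow]
  have hv' (x : Fin n → ℝ) : (Matrix.of fun i j => P i (x j)).det *
      (Matrix.of fun i j => P i (x j)).det = a * vandSq x := by rw [← hv, pow_two]
  simp_rw [hv'] at hden hden_int
  have hfac : (0 : ℝ) < n.factorial := by exact_mod_cast n.factorial_pos
  rw [integral_const_mul] at hden
  have ha0 : a ≠ 0 := by rintro h; rw [h, zero_mul] at hden; exact hfac.ne hden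
  have hapos : 0 < a := lt_of_le_of_ne (sq_nonneg _) ha0.symm
  have h_int : Integrable (vandSq : (Fin n → ℝ) → ℝ) (Measure.pi fun _ => μ) := by
    have := hden_int.const_mul a⁻¹
    simpa [← mul_assoc, ha0] using this
  have hpos : 0 < ∫ x : Fin n → ℝ, vandSq x ∂(Measure.pi fun _ => μ) :=
    pos_of_mul_pos_right (hden ▸ hfac) hapos.le
  have := isProbabilityMeasure_OPE μ h_int hpos
  have hXc : Continuous fun l : Fin n → ℝ => linStat f l := by unfold linStat; fun_prop
  have hX : AEStronglyMeasurable (fun l : Fin n → ℝ => linStat f l) (OPE μ n) :=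
    hXc.aestronglyMeasurable
  rw [← variance_sub_const hX (∑ k, c k k)]
  refine (variance_le_expectation_sq (hX.sub aestronglyMeasurable_const)).trans (le_of_eq ?_)
  simp_rw [hv, mul_left_comm _ a] at hnum
  rw [integral_const_mul] at hnum
  simp only [Pi.pow_apply]
  rw [integral_OPE μ h_int]
  rw [inv_mul_eq_iff_eq_mul₀ hpos.ne', ← mul_right_inj' ha0]
  refine hnum.trans ?_
  rw [← hden]
  ring

/-- A measure with infinite support has a sequence of orthonormal polynomials whose first `n`
members span the polynomials of degree less than `n`. -/
theorem exists_orthonormal_polynomials (μ : Measure ℝ)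
    (hI : ∀ g : ℝ → ℝ, Continuous g → Integrable g μ) (hinf : InfiniteSupport μ) :
    ∃ p : ℕ → Polynomial ℝ,
      (∀ i j, ∫ x, (p i).eval x * (p j).eval x ∂μ = if i = j then 1 else 0) ∧
      ∀ n, Submodule.span ℝ (p '' Set.Iio n) = Polynomial.degreeLT ℝ n := by
  let core : InnerProductSpace.Core ℝ (Polynomial ℝ) :=
    { inner := fun p q => ∫ x, p.eval x * q.eval x ∂μ
      conj_inner_symm := fun p q => by simp [mul_comm]
      re_inner_nonneg := fun p => integral_nonneg fun x => mul_self_nonneg _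
      add_left := fun p q r => by
        simp only [Polynomial.eval_add, add_mul]
        exact integral_add (hI _ (by fun_prop)) (hI _ (by fun_prop))
      smul_left := fun p q c => by
        simp [mul_assoc, integral_const_mul]
      definite := fun p hp => by
        by_contra h0
        refine hinf p.roots.toFinset ?_
        have hp : ∫ x, p.eval x * p.eval x ∂μ = 0 := hp
        rw [integral_eq_zero_iff_of_nonneg (fun x => mul_self_nonneg _)
          (hI _ (p.continuous.mul p.continuous))] at hp
        refine measure_mono_null (fun x hx => ?_) (ae_iff.1 hp)
        simpa [h0] using hx }
  let _ : NormedAddCommGroup (Polynomial ℝ) := core.toNormedAddCommGroup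
  let _ : InnerProductSpace ℝ (Polynomial ℝ) := .ofCore core.toCore
  have hli : LinearIndependent ℝ (fun k : ℕ => (Polynomial.X ^ k : Polynomial ℝ)) := by
    have := (Polynomial.basisMonomials ℝ).linearIndependent
    simpa [Polynomial.X_pow_eq_monomial] using this
  refine ⟨InnerProductSpace.gramSchmidtNormed ℝ fun k : ℕ => Polynomial.X ^ k, fun i j => ?_,
    fun n => ?_⟩
  · exact orthonormal_iff_ite.1 (InnerProductSpace.gramSchmidtNormed_orthonormal hli) i j
  · rw [InnerProductSpace.span_gramSchmidtNormed, InnerProductSpace.span_gramSchmidt_Iio,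
      Polynomial.degreeLT_eq_span_X_pow]
    congr 1
    ext; simp

/-- If the continuous function `f`, bounded by `C`, is within `δ` of the polynomial `q` almost
everywhere, then the variance of its linear statistic is at most `n δ² + deg(q) C²`. -/
theorem variance_linStat_le_of_near_polynomial (μ : Measure ℝ) [IsProbabilityMeasure μ]
    (hI : ∀ g : ℝ → ℝ, Continuous g → Integrable g μ) (hinf : InfiniteSupport μ)
    (f : ℝ → ℝ) (hf : Continuous f) {C : ℝ} (hC : ∀ x, |f x| ≤ C) (q : Polynomial ℝ) {δ : ℝ}
    (hq : ∀ᵐ x ∂μ, |q.eval x - f x| ≤ δ) (n : ℕ) :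
    variance (fun l : Fin n → ℝ => linStat f l) (OPE μ n) ≤ n * δ ^ 2 + q.natDegree * C ^ 2 := by
  obtain ⟨p, ho, hspan⟩ := exists_orthonormal_polynomials μ hI hinf
  have hmem {k m : ℕ} (hk : k < m) : p k ∈ Polynomial.degreeLT ℝ m :=
    hspan m ▸ Submodule.subset_span ⟨k, hk, rfl⟩
  have hdeg (k : ℕ) : (p k).natDegree < k + 1 := by
    refine (Polynomial.natDegree_lt_iff_degree_lt fun h => ?_).2
      (Polynomial.mem_degreeLT.1 (hmem k.lt_succ_self))
    simpa [h] using ho k k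
  have ho' (i j : Fin n) : ∫ x, (p i).eval x * (p j).eval x ∂μ = if i = j then 1 else 0 := by
    simp [ho, Fin.ext_iff]
  have bound (g : ℝ → ℝ) (hg : Continuous g) (D : ℝ) (hD : ∀ᵐ x ∂μ, |g x| ≤ D) (k : ℕ) :
      ∫ x, (g x * (p k).eval x) ^ 2 ∂μ ≤ D ^ 2 := by
    calc ∫ x, (g x * (p k).eval x) ^ 2 ∂μ
        ≤ ∫ x, D ^ 2 * ((p k).eval x * (p k).eval x) ∂μ := by
          refine integral_mono_ae (hI _ (by fun_prop)) (hI _ (by fun_prop)) ?_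
          filter_upwards [hD] with x hx
          have : g x ^ 2 ≤ D ^ 2 := sq_le_sq' (abs_le.1 hx).1 (abs_le.1 hx).2
          nlinarith [mul_le_mul_of_nonneg_right this (sq_nonneg ((p k).eval x))]
      _ = D ^ 2 := by rw [integral_const_mul, ho]; simp
  refine (variance_linStat_le μ hI (fun i : Fin n => p i) (fun i => hmem i.2) ho' f hf).trans ?_
  have key (k : Fin n) : ∫ x, (f x * (p k).eval x -
      ∑ j : Fin n, (∫ y, f y * (p k).eval y * (p j).eval y ∂μ) * (p j).eval x) ^ 2 ∂μ ≤
      δ ^ 2 + if (k : ℕ) + q.natDegree < n then 0 else C ^ 2 := by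
    have best := integral_sub_proj_sq_le μ hI (fun i : Fin n => fun x => (p i).eval x)
      (fun i => (p i).continuous) ho' (fun x => f x * (p k).eval x) (by fun_prop)
    split_ifs with hk
    · have hqk : q * p k ∈ Polynomial.degreeLT ℝ n := by
        rw [Polynomial.mem_degreeLT]
        refine Polynomial.degree_le_natDegree.trans_lt ?_
        have h1 := Polynomial.natDegree_mul_le (p := q) (q := p k)
        have h2 := hdeg k
        exact_mod_cast (by omega : (q * p k).natDegree < n)
      have hrange : p '' Set.Iio n = Set.range fun i : Fin n => p i := by
        ext y
        constructor
        · rintro ⟨i, hi, rfl⟩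
          exact ⟨⟨i, hi⟩, rfl⟩
        · rintro ⟨i, rfl⟩
          exact ⟨i, i.2, rfl⟩
      rw [← hspan, hrange, Submodule.mem_span_range_iff_exists_fun] at hqk
      obtain ⟨c, hc⟩ := hqk
      refine (best c).trans ?_
      rw [add_zero]
      refine le_trans (le_of_eq ?_) (bound (fun x => f x - q.eval x) (by fun_prop) δ ?_ k)
      · refine integral_congr_ae (.of_forall fun x => ?_)
        have := congrArg (Polynomial.eval x) hc
        simp only [Polynomial.eval_finsetSum, Polynomial.eval_smul, smul_eq_mul,
          Polynomial.eval_mul] at this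
        simp only [this]
        ring
      · filter_upwards [hq] with x hx
        rwa [abs_sub_comm]
    · refine (best 0).trans ?_
      have := bound f hf C (.of_forall hC) k
      simp only [Pi.zero_apply, zero_mul, Finset.sum_const_zero, sub_zero]
      nlinarith [sq_nonneg δ]
  refine (Finset.sum_le_sum fun k _ => key k).trans ?_
  rw [Finset.sum_add_distrib, Finset.sum_const, Finset.card_univ, Fintype.card_fin, nsmul_eq_mul,
    Fin.sum_univ_eq_sum_range (fun k => if k + q.natDegree < n then 0 else C ^ 2) n,
    Finset.sum_ite, Finset.sum_const_zero, zero_add, Finset.sum_const, nsmul_eq_mul]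
  gcongr
  calc ((Finset.range n).filter fun k => ¬ k + q.natDegree < n).card
      ≤ (Finset.Ico (n - q.natDegree) n).card := Finset.card_le_card fun k hk => by
        simp only [Finset.mem_filter, Finset.mem_range, Finset.mem_Ico] at hk ⊢
        omega
    _ ≤ q.natDegree := by rw [Nat.card_Ico]; omega

/-- **Variance is `o(n)` for continuous `f`** (Proposition 4.2, first part): if `μ` is a
compactly supported probability measure on `ℝ` with infinite support and `f` is bounded
and continuous, then `Var X_f^{(n)} = o(n)` as `n → ∞`. -/
theorem variance_little_o_continuous
    (μ : Measure ℝ) (hprob : IsProbabilityMeasure μ)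
    (hinf : InfiniteSupport μ)
    (hcs : ∃ K : Set ℝ, IsCompact K ∧ μ Kᶜ = 0)
    (f : ℝ → ℝ) (hf : Continuous f) (hfb : ∃ C : ℝ, ∀ x, |f x| ≤ C) :
    Tendsto (fun n : ℕ =>
        variance (fun l : Fin n → ℝ => linStat f l) (OPE μ n) / n) atTop (𝓝 0) := by
  obtain ⟨K, hK, hKμ⟩ := hcs
  obtain ⟨C, hC⟩ := hfb
  have hmemK : ∀ᵐ x ∂μ, x ∈ K := hKμ
  have hI (g : ℝ → ℝ) (hg : Continuous g) : Integrable g μ := by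
    have := hg.continuousOn.integrableOn_compact (μ := μ) hK
    rwa [IntegrableOn, Measure.restrict_eq_self_of_ae_mem hmemK] at this
  obtain ⟨a, b, hab⟩ : ∃ a b, K ⊆ Set.Icc a b := by
    obtain ⟨a, ha⟩ := hK.bddBelow
    obtain ⟨b, hb⟩ := hK.bddAbove
    exact ⟨a, b, fun x hx => ⟨ha hx, hb hx⟩⟩
  rw [Metric.tendsto_atTop]
  intro ε hε
  obtain ⟨q, hq⟩ := exists_polynomial_near_of_continuousOn a b f hf.continuousOn
    (Real.sqrt (ε / 2)) (Real.sqrt_pos.2 (half_pos hε))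
  have hqae : ∀ᵐ x ∂μ, |q.eval x - f x| ≤ Real.sqrt (ε / 2) := by
    filter_upwards [hmemK] with x hx using (hq x (hab hx)).le
  obtain ⟨N, hN⟩ := Filter.eventually_atTop.1 ((tendsto_const_div_atTop_nhds_zero_nat
    ((q.natDegree : ℝ) * C ^ 2)).eventually_lt_const (half_pos hε))
  refine ⟨max N 1, fun n hn => ?_⟩
  have hn0 : (0 : ℝ) < n := by exact_mod_cast (le_max_right N 1).trans hn
  rw [Real.dist_eq, sub_zero, abs_of_nonneg (div_nonneg (variance_nonneg _ _) hn0.le)]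
  have hvar := variance_linStat_le_of_near_polynomial μ hI hinf f hf hC q hqae n
  rw [Real.sq_sqrt (half_pos hε).le] at hvar
  have hNn := hN n ((le_max_left N 1).trans hn)
  rw [div_lt_iff₀ hn0] at hNn ⊢
  linarith

end
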